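/- arXiv:2411.10653 — 4 statements merged into one kernel-verified Lean document; each statement's English description precedes it below -/
import Mathlib

section
/- Let F be a 3-CNF formula over n Boolean variables and S the indeterminate string over {0,1,$} constructed from F as described. Then every bitstring B ∈ {0,1}^n occurs in S at at least one position, and B is a unique substring of S (occurs at exactly one position) if and only if the assignment encoded by B satisfies F. -/
/-- A 3-clause over Boolean variables `x_0, …, x_{n-1}`: it consists of three
literals on three distinct variables `a < b < c`; the Booleans `na`, `nb`, `nc`
record whether the respective literal is negated (so, in the paper's notation,
`v_a = na`, `v_b = nb`, `v_c = nc`, reading the bit `0` as `false` and `1` as `true`). -/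
structure Clause3 (n : ℕ) where
  a : Fin n
  b : Fin n
  c : Fin n
  hab : a < b
  hbc : b < c
  na : Bool
  nb : Bool
  nc : Bool

/-- The clause `C` is satisfied by the assignment `σ`:
some literal of `C` evaluates to true. -/
def Clause3.Sat {n : ℕ} (C : Clause3 n) (σ : Fin n → Bool) : Prop :=
  σ C.a ≠ C.na ∨ σ C.b ≠ C.nb ∨ σ C.c ≠ C.nc

/-- The language of an indeterminate string `S` (a list of nonempty sets of
characters): all classic strings of the same length as `S` choosing, at each
position, a character of the corresponding symbol. -/
def Lang {α : Type*} (S : List (Set α)) : Set (List α) :=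
  {X | List.Forall₂ (fun x A => x ∈ A) X S}

/-- The classic string `P` occurs in the indeterminate string `S` at
(0-based) position `i`: some `X ∈ L(S)` has `P` as the substring of
length `|P|` starting at position `i`. -/
def OccursAt {α : Type*} (S : List (Set α)) (P : List α) (i : ℕ) : Prop :=
  ∃ X ∈ Lang S, (X.drop i).take P.length = P

/-- We model the alphabet `{0, 1, $}` as `Option Bool`:
`some false` is `0`, `some true` is `1`, and `none` is `$`. -/
abbrev OB := Option Bool

/-- The symbol `{0, 1}`. -/
def bitSym : Set OB := {some false, some true}

/-- The symbol `{$}`. -/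
def dolSym : Set OB := {none}

/-- The symbol `{0, 1, $}`. -/
def triSym : Set OB := {some false, some true, none}

/-- The indeterminate string `T_j` (over `{0,1}`, here embedded into `{0,1,$}`)
built from the clause `C = C_j`: position `a` carries `{v_a}`, position `b`
carries `{v_b}`, position `c` carries `{v_c}`, every other position carries `{0,1}`. -/
def clauseStr (n : ℕ) (C : Clause3 n) : List (Set OB) :=
  (List.finRange n).map fun i =>
    if i = C.a then {some C.na}
    else if i = C.b then {some C.nb}
    else if i = C.c then {some C.nc}
    else bitSym

/-- The indeterminate string
`S = T_1 · {$} · … · {$} · T_m · {$} · {0,1}^n · {$} · {0,1}^{n-1} · {$} · {0,1}^{n-1}`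
of the MUS reduction. -/
def musS (n : ℕ) (F : List (Clause3 n)) : List (Set OB) :=
  (F.map fun C => clauseStr n C ++ [dolSym]).flatten ++
    List.replicate n bitSym ++ [dolSym] ++
    List.replicate (n - 1) bitSym ++ [dolSym] ++
    List.replicate (n - 1) bitSym

/-- The indeterminate string
`S' = T_1 · {$} · … · {$} · T_m · {$} · {0,1,$}^{n-1} · {$} · {0,1}^{n-1}`
of the MAW (absent word) reduction. -/
def mawS (n : ℕ) (F : List (Clause3 n)) : List (Set OB) :=
  (F.map fun C => clauseStr n C ++ [dolSym]).flatten ++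
    List.replicate (n - 1) triSym ++ [dolSym] ++
    List.replicate (n - 1) bitSym

/-- The bitstring (over `{0,1} ⊆ {0,1,$}`) of length `n` encoding the
assignment `σ`: its `i`-th character is `1` iff `σ i` is true. -/
def bits {n : ℕ} (σ : Fin n → Bool) : List OB :=
  List.ofFn fun i => some (σ i)

/-- Index form of an occurrence. -/
def Occ {n : ℕ} (S : List (Set OB)) (σ : Fin n → Bool) (i : ℕ) : Prop :=
  ∀ k : Fin n, ∃ A, S[i + k.1]? = some A ∧ some (σ k) ∈ A

theorem occ_iff {n : ℕ} (S : List (Set OB)) (hS : ∀ A ∈ S, A.Nonempty) (hn : 0 < n)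
    (σ : Fin n → Bool) (i : ℕ) : OccursAt S (bits σ) i ↔ Occ S σ i := by
  constructor
  · rintro ⟨X, hX, h⟩ k
    have hX' : List.Forall₂ (fun x A => x ∈ A) X S := hX
    rw [List.forall₂_iff_get] at hX'
    obtain ⟨hl, hg⟩ := hX'
    have h2 : ((X.drop i).take (bits σ).length)[k.1]? = some (some (σ k)) := by
      rw [h]; simp [bits]
    have hk := k.2
    simp only [bits, List.length_ofFn, List.getElem?_take, hk, if_true, List.getElem?_drop] at h2
    obtain ⟨h3, h4⟩ := List.getElem?_eq_some_iff.1 h2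
    refine ⟨S[i + k.1], List.getElem?_eq_getElem (by omega), ?_⟩
    have := hg (i + k.1) h3 (by omega)
    simp only [List.get_eq_getElem] at this
    rwa [h4] at this
  · intro h
    have hlen : i + n ≤ S.length := by
      obtain ⟨A, hA, -⟩ := h ⟨n - 1, by omega⟩
      obtain ⟨h3, -⟩ := List.getElem?_eq_some_iff.1 hA
      simp only at h3
      omega
    let f : Fin S.length → OB := fun j =>
      if hj : i ≤ j.1 ∧ j.1 - i < n then some (σ ⟨j.1 - i, hj.2⟩)
      else (hS S[j.1] (List.getElem_mem _)).some
    refine ⟨List.ofFn f, ?_, ?_⟩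
    · show List.Forall₂ (fun x A => x ∈ A) (List.ofFn f) S
      rw [List.forall₂_iff_get]
      refine ⟨by simp, ?_⟩
      intro j h1 h2
      simp only [List.get_eq_getElem, List.getElem_ofFn, f]
      split_ifs with hj
      · obtain ⟨A, hA, hm⟩ := h ⟨j - i, hj.2⟩
        have e : i + (j - i) = j := by omega
        simp only [e] at hA
        obtain ⟨h3, h4⟩ := List.getElem?_eq_some_iff.1 hA
        rw [h4]; exact hm
      · exact (hS S[j] (List.getElem_mem _)).some_mem
    · apply List.ext_getElem
      · simp [bits]; omega
      · intro k h1 h2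
        have hk : k < n := by simpa [bits] using h2
        simp [bits, f, hk]

theorem occ_append {n : ℕ} (A R : List (Set OB)) (σ : Fin n → Bool) (hA : A.length ≤ n) (i : ℕ)
    (h : Occ (A ++ dolSym :: R) σ i) :
    (i = 0 ∧ A.length = n) ∨ ∃ j, i = A.length + 1 + j ∧ Occ R σ j := by
  by_cases hi : i ≤ A.length
  · left
    by_contra hc
    obtain ⟨B, hB, hm⟩ := h ⟨A.length - i, by omega⟩
    have e : i + (A.length - i) = A.length := by omega
    simp [e] at hB
    subst hB
    simp [dolSym] at hm
  · right
    refine ⟨i - (A.length + 1), by omega, ?_⟩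
    intro k
    obtain ⟨B, hB, hm⟩ := h k
    refine ⟨B, ?_, hm⟩
    rw [List.getElem?_append_right (by omega)] at hB
    have e : i + k.1 - A.length = (i - (A.length + 1) + k.1) + 1 := by omega
    rw [e] at hB
    simpa using hB

theorem occ_shift {n : ℕ} (A R : List (Set OB)) (σ : Fin n → Bool) (j : ℕ)
    (h : Occ R σ j) : Occ (A ++ dolSym :: R) σ (A.length + 1 + j) := by
  intro k
  obtain ⟨B, hB, hm⟩ := h k
  refine ⟨B, ?_, hm⟩
  rw [List.getElem?_append_right (by omega)]
  have e : A.length + 1 + j + k.1 - A.length = (j + k.1) + 1 := by omega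
  rw [e]
  simpa using hB

theorem occ_zero {n : ℕ} (A R : List (Set OB)) (σ : Fin n → Bool) (hA : A.length = n) :
    Occ (A ++ R) σ 0 ↔ Occ A σ 0 := by
  unfold Occ
  apply forall_congr'
  intro k
  rw [List.getElem?_append_left (by omega)]

theorem occ_clause {n : ℕ} (C : Clause3 n) (σ : Fin n → Bool) :
    Occ (clauseStr n C) σ 0 ↔ ¬ C.Sat σ := by
  have hab := C.hab
  have hbc := C.hbc
  have key : Occ (clauseStr n C) σ 0 ↔ ∀ k : Fin n, some (σ k) ∈
      (if k = C.a then ({some C.na} : Set OB)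
        else if k = C.b then {some C.nb}
        else if k = C.c then {some C.nc}
        else bitSym) := by
    unfold Occ
    apply forall_congr'
    intro k
    simp [clauseStr]
  rw [key]
  unfold Clause3.Sat
  push Not
  constructor
  · intro h
    have ha := h C.a
    have hb := h C.b
    have hc := h C.c
    rw [if_pos rfl] at ha
    rw [if_neg hab.ne', if_pos rfl] at hb
    rw [if_neg (hab.trans hbc).ne', if_neg hbc.ne', if_pos rfl] at hc
    simp at ha hb hc
    exact ⟨ha, hb, hc⟩
  · rintro ⟨ha, hb, hc⟩ k
    split_ifs with h1 h2 h3
    · simp [h1, ha]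
    · simp [h2, hb]
    · simp [h3, hc]
    · cases σ k <;> simp [bitSym]

theorem clauseStr_length {n : ℕ} (C : Clause3 n) : (clauseStr n C).length = n := by
  simp [clauseStr]

theorem musS_cons {n : ℕ} (C : Clause3 n) (F : List (Clause3 n)) :
    musS n (C :: F) = clauseStr n C ++ dolSym :: musS n F := by
  simp [musS]

theorem musS_nil (n : ℕ) :
    musS n [] = List.replicate n bitSym ++ dolSym ::
      (List.replicate (n - 1) bitSym ++ dolSym :: List.replicate (n - 1) bitSym) := by
  simp [musS]

theorem musS_nonempty {n : ℕ} (F : List (Clause3 n)) : ∀ A ∈ musS n F, A.Nonempty := by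
  have hb : bitSym.Nonempty := ⟨some false, by simp [bitSym]⟩
  have hd : dolSym.Nonempty := ⟨none, by simp [dolSym]⟩
  induction F with
  | nil =>
    intro A hA
    rw [musS_nil] at hA
    simp only [List.mem_append, List.mem_cons, List.mem_replicate] at hA
    rcases hA with h | h | h | h | h
    · rw [h.2]; exact hb
    · rw [h]; exact hd
    · rw [h.2]; exact hb
    · rw [h]; exact hd
    · rw [h.2]; exact hb
  | cons C F ih =>
    intro A hA
    rw [musS_cons] at hA
    simp only [List.mem_append, List.mem_cons] at hA
    rcases hA with h | h | h
    · simp only [clauseStr, List.mem_map] at h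
      obtain ⟨k, -, rfl⟩ := h
      split_ifs
      · simp
      · simp
      · simp
      · exact hb
    · rw [h]; exact hd
    · exact ih A h

theorem occ_nil {n : ℕ} (hn : 0 < n) (σ : Fin n → Bool) (i : ℕ) :
    Occ (musS n []) σ i ↔ i = 0 := by
  rw [musS_nil]
  constructor
  · intro h
    rcases occ_append _ _ σ (by simp) i h with h | ⟨j, -, h⟩
    · exact h.1
    · exfalso
      rcases occ_append _ _ σ (by simp) j h with h | ⟨l, -, h⟩
      · have := h.2
        simp at this
        omega
      · obtain ⟨A, hA, -⟩ := h ⟨n - 1, by omega⟩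
        obtain ⟨h3, -⟩ := List.getElem?_eq_some_iff.1 hA
        simp at h3
  · rintro rfl
    rw [occ_zero _ _ _ (by simp)]
    intro k
    refine ⟨bitSym, by simp, ?_⟩
    cases σ k <;> simp [bitSym]

theorem occ_cons {n : ℕ} (C : Clause3 n) (F : List (Clause3 n)) (σ : Fin n → Bool) (i : ℕ) :
    Occ (musS n (C :: F)) σ i ↔
      (i = 0 ∧ ¬ C.Sat σ) ∨ ∃ j, i = n + 1 + j ∧ Occ (musS n F) σ j := by
  have hl := clauseStr_length C
  rw [musS_cons]
  constructor
  · intro h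
    rcases occ_append _ _ σ hl.le i h with ⟨h0, -⟩ | h'
    · left
      subst h0
      rw [occ_zero _ _ _ hl, occ_clause] at h
      exact ⟨rfl, h⟩
    · right
      rwa [hl] at h'
  · rintro (⟨rfl, h⟩ | ⟨j, rfl, h⟩)
    · rwa [occ_zero _ _ _ hl, occ_clause]
    · have := occ_shift (clauseStr n C) _ σ j h
      rwa [hl] at this

theorem occ_last {n : ℕ} (hn : 0 < n) (F : List (Clause3 n)) (σ : Fin n → Bool) :
    Occ (musS n F) σ (F.length * (n + 1)) := by
  induction F with
  | nil => rw [occ_nil hn]; simp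
  | cons C F ih =>
    rw [occ_cons]
    exact Or.inr ⟨_, by simp only [List.length_cons]; ring, ih⟩

theorem occ_sat {n : ℕ} (hn : 0 < n) (F : List (Clause3 n)) (σ : Fin n → Bool)
    (h : ∀ C ∈ F, C.Sat σ) (i : ℕ) (hi : Occ (musS n F) σ i) : i = F.length * (n + 1) := by
  induction F generalizing i with
  | nil => rw [occ_nil hn] at hi; simp [hi]
  | cons C F ih =>
    rw [occ_cons] at hi
    rcases hi with ⟨-, h'⟩ | ⟨j, rfl, hj⟩
    · exact absurd (h C (by simp)) h'
    · rw [ih (fun D hD => h D (by simp [hD])) j hj]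
      simp only [List.length_cons]; ring

theorem occ_unsat {n : ℕ} (F : List (Clause3 n)) (σ : Fin n → Bool)
    (C : Clause3 n) (hC : C ∈ F) (h : ¬ C.Sat σ) :
    ∃ i, i < F.length * (n + 1) ∧ Occ (musS n F) σ i := by
  induction F with
  | nil => simp at hC
  | cons D F ih =>
    rcases List.mem_cons.1 hC with rfl | hC
    · exact ⟨0, by simp, (occ_cons _ _ _ _).2 (Or.inl ⟨rfl, h⟩)⟩
    · obtain ⟨i, hi, ho⟩ := ih hC
      refine ⟨n + 1 + i, ?_, (occ_cons _ _ _ _).2 (Or.inr ⟨i, rfl, ho⟩)⟩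
      simp only [List.length_cons]
      rw [Nat.succ_mul]; omega

/-- Every bitstring `B ∈ {0,1}^n` (encoded by an assignment `σ`
via `bits σ`, which ranges over exactly the bitstrings of length `n`) occurs in `S`
at at least one position, and `B` is a unique substring of `S` (occurs at exactly
one position) iff the assignment encoded by `B` satisfies `F`. -/
theorem bitstring_occurs_and_unique_iff_sat
    (n : ℕ) (hn : 0 < n) (F : List (Clause3 n)) (σ : Fin n → Bool) :
    (∃ i : ℕ, OccursAt (musS n F) (bits σ) i) ∧
    ((∃! i : ℕ, OccursAt (musS n F) (bits σ) i) ↔ ∀ C ∈ F, C.Sat σ) := by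
  simp only [occ_iff (musS n F) (musS_nonempty F) hn σ]
  refine ⟨⟨_, occ_last hn F σ⟩, ?_, ?_⟩
  · intro h C hC
    by_contra hs
    obtain ⟨i, hi, ho⟩ := occ_unsat F σ C hC hs
    have := h.unique ho (occ_last hn F σ)
    omega
  · intro h
    exact ⟨_, occ_last hn F σ, fun i hi => occ_sat hn F σ h i hi⟩
end

section
/- Let F be a 3-CNF formula over n Boolean variables and S' the indeterminate string over {0,1,$} constructed from F for the absent-word reduction as described. Then there exists a nonempty string of length at most n that is absent from S' if and only if F is satisfiable. -/
theorem aux_exists_lang {α : Type*} (S : List (Set α)) (h : ∀ A ∈ S, A.Nonempty) :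
    ∃ X, X ∈ Lang S := by
  induction S with
  | nil => exact ⟨[], List.Forall₂.nil⟩
  | cons A S ih =>
    obtain ⟨X, hX⟩ := ih (fun B hB => h B (List.mem_cons_of_mem _ hB))
    obtain ⟨x, hx⟩ := h A List.mem_cons_self
    exact ⟨x :: X, List.Forall₂.cons hx hX⟩

theorem aux_occurs {α : Type*} (A M B : List (Set α)) (P : List α)
    (h : ∀ Z ∈ A ++ (M ++ B), Z.Nonempty)
    (hP : List.Forall₂ (fun x A => x ∈ A) P M) :
    ∃ i, OccursAt (A ++ (M ++ B)) P i := by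
  obtain ⟨X, hX⟩ := aux_exists_lang A (fun Z hZ => h Z (by simp [hZ]))
  obtain ⟨Y, hY⟩ := aux_exists_lang B (fun Z hZ => h Z (by simp [hZ]))
  refine ⟨X.length, X ++ (P ++ Y), ?_, by simp⟩
  exact List.rel_append hX (List.rel_append hP hY)

theorem aux_pointwise {n : ℕ} (S : List (Set OB)) (σ : Fin n → Bool) (i : ℕ)
    (h : OccursAt S (bits σ) i) (k : Fin n) :
    ∃ A, S[i + k]? = some A ∧ some (σ k) ∈ A := by
  obtain ⟨X, hX, hP⟩ := h
  have hl := List.Forall₂.length_eq hX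
  have h1 : ((X.drop i).take (bits σ).length)[(k : ℕ)]? = some (some (σ k)) := by
    rw [hP]; simp [bits]
  have hk := k.2
  have h2 : X[i + k]? = some (some (σ k)) := by
    rw [List.getElem?_take] at h1
    split_ifs at h1
    rwa [List.getElem?_drop] at h1
  obtain ⟨hlt, he⟩ := List.getElem?_eq_some_iff.1 h2
  have hlt' : i + k < S.length := hl ▸ hlt
  refine ⟨S[i + k], List.getElem?_eq_getElem hlt', ?_⟩
  have := (List.forall₂_iff_get.1 hX).2 (i + k) hlt hlt'
  simpa [he] using this

theorem aux_cons (n : ℕ) (C : Clause3 n) (F : List (Clause3 n)) :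
    mawS n (C :: F) = clauseStr n C ++ dolSym :: mawS n F := by
  simp [mawS]

theorem aux_len (n : ℕ) (C : Clause3 n) : (clauseStr n C).length = n := by
  simp [clauseStr]

theorem aux_absent (n : ℕ) (hn : 0 < n) (σ : Fin n → Bool) (F : List (Clause3 n))
    (hF : ∀ C ∈ F, C.Sat σ) :
    ∀ i : ℕ, ¬ ∀ k : Fin n, ∃ A, (mawS n F)[i + (k : ℕ)]? = some A ∧ some (σ k) ∈ A := by
  induction F with
  | nil =>
    intro i h
    by_cases hi : i ≤ n - 1
    · obtain ⟨A, hA, hs⟩ := h ⟨n - 1 - i, by omega⟩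
      have e : i + (n - 1 - i) = n - 1 := by omega
      simp only [e] at hA
      simp [mawS] at hA
      subst hA
      simp [dolSym] at hs
    · obtain ⟨A, hA, hs⟩ := h ⟨n - 1, by omega⟩
      obtain ⟨hlt, -⟩ := List.getElem?_eq_some_iff.1 hA
      simp [mawS] at hlt
      omega
  | cons C F ih =>
    intro i h
    have ih := ih (fun D hD => hF D (List.mem_cons_of_mem _ hD))
    have hC := hF C List.mem_cons_self
    rw [aux_cons] at h
    by_cases h0 : i = 0
    · subst h0
      have key : ∀ k : Fin n, some (σ k) ∈ (if k = C.a then {some C.na}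
          else if k = C.b then {some C.nb}
          else if k = C.c then {some C.nc}
          else bitSym : Set OB) := by
        intro k
        obtain ⟨A, hA, hs⟩ := h k
        have hk := k.2
        rw [zero_add, List.getElem?_append_left (by rw [aux_len]; exact hk)] at hA
        simp [clauseStr] at hA
        rw [hA]
        exact hs
      have hab := C.hab
      have hbc := C.hbc
      have ha := key C.a
      have hb := key C.b
      have hc := key C.c
      simp [hab.ne'] at ha hb
      simp [hbc.ne', (hab.trans hbc).ne'] at hc
      rcases hC with h | h | h <;> contradiction
    · by_cases hi : i ≤ n
      · obtain ⟨A, hA, hs⟩ := h ⟨n - i, by omega⟩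
        have e : i + (n - i) = n := by omega
        simp only [e] at hA
        rw [List.getElem?_append_right (by rw [aux_len]), aux_len] at hA
        simp at hA
        subst hA
        simp [dolSym] at hs
      · apply ih (i - (n + 1))
        intro k
        obtain ⟨A, hA, hs⟩ := h k
        refine ⟨A, ?_, hs⟩
        rw [List.getElem?_append_right (by rw [aux_len]; omega), aux_len] at hA
        have e : i + (k : ℕ) - n = (i - (n + 1) + k) + 1 := by omega
        rw [e, List.getElem?_cons_succ] at hA
        exact hA

theorem aux_nonempty (n : ℕ) (F : List (Clause3 n)) : ∀ Z ∈ mawS n F, Z.Nonempty := by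
  have hb : bitSym.Nonempty := ⟨some false, by simp [bitSym]⟩
  have hd : dolSym.Nonempty := ⟨none, by simp [dolSym]⟩
  have ht : triSym.Nonempty := ⟨none, by simp [triSym]⟩
  induction F with
  | nil =>
    intro Z hZ
    simp [mawS] at hZ
    rcases hZ with h | h | h
    · rw [h.2]; exact ht
    · rw [h]; exact hd
    · rw [h.2]; exact hb
  | cons C F ih =>
    intro Z hZ
    rw [aux_cons] at hZ
    simp only [List.mem_append, List.mem_cons] at hZ
    rcases hZ with h | h | h
    · simp only [clauseStr, List.mem_map] at h
      obtain ⟨k, -, rfl⟩ := h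
      split_ifs
      · exact ⟨_, rfl⟩
      · exact ⟨_, rfl⟩
      · exact ⟨_, rfl⟩
      · exact hb
    · rw [h]; exact hd
    · exact ih Z h

theorem aux_tri (P : List OB) : List.Forall₂ (fun x A => x ∈ A) P
    (List.replicate P.length triSym) := by
  induction P with
  | nil => exact List.Forall₂.nil
  | cons x P ih =>
    refine List.Forall₂.cons ?_ ih
    rcases x with _ | _ | _ <;> simp [triSym]

theorem aux_bit (P : List OB) (h : none ∉ P) : List.Forall₂ (fun x A => x ∈ A) P
    (List.replicate P.length bitSym) := by
  induction P with
  | nil => exact List.Forall₂.nil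
  | cons x P ih =>
    refine List.Forall₂.cons ?_ (ih (fun hx => h (List.mem_cons_of_mem _ hx)))
    rcases x with _ | _ | _
    · simp at h
    all_goals simp [bitSym]

theorem aux_split (P : List OB) (h : none ∈ P) :
    ∃ u v, P = u ++ none :: v ∧ none ∉ v := by
  induction P with
  | nil => simp at h
  | cons x P ih =>
    by_cases hp : none ∈ P
    · obtain ⟨u, v, rfl, hv⟩ := ih hp
      exact ⟨x :: u, v, rfl, hv⟩
    · have : x = none := by
        rcases List.mem_cons.1 h with h | h
        · exact h.symm
        · exact absurd h hp
      exact ⟨[], P, by simp [this], hp⟩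

theorem aux_bits {n : ℕ} (P : List OB) (hl : P.length = n) (h : none ∉ P) :
    ∃ σ : Fin n → Bool, P = bits σ := by
  subst hl
  refine ⟨fun i => (P.get i).getD false, ?_⟩
  apply List.ext_getElem (by simp [bits])
  intro i h1 h2
  simp only [bits, List.getElem_ofFn, List.get_eq_getElem]
  have : P[i] ≠ none := fun e => h (e ▸ List.getElem_mem h1)
  cases hh : P[i] with
  | none => exact absurd hh this
  | some b => rfl

theorem aux_clause {n : ℕ} (C : Clause3 n) (σ : Fin n → Bool) (h : ¬ C.Sat σ) :
    List.Forall₂ (fun x A => x ∈ A) (bits σ) (clauseStr n C) := by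
  rw [List.forall₂_iff_get]
  refine ⟨by simp [bits, clauseStr], ?_⟩
  intro i h1 h2
  simp only [Clause3.Sat, not_or, not_not] at h
  obtain ⟨ha, hb, hc⟩ := h
  simp only [bits, clauseStr, List.get_eq_getElem, List.getElem_ofFn, List.getElem_map,
    List.getElem_finRange]
  split_ifs with e1 e2 e3
  · rw [← ha, ← e1]; rfl
  · rw [← hb, ← e2]; rfl
  · rw [← hc, ← e3]; rfl
  · cases σ _ <;> simp [bitSym]

theorem aux_clause_mem {n : ℕ} (F : List (Clause3 n)) (C : Clause3 n) (h : C ∈ F) :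
    ∃ A B, mawS n F = A ++ (clauseStr n C ++ B) := by
  induction F with
  | nil => simp at h
  | cons D F ih =>
    rw [aux_cons]
    rcases List.mem_cons.1 h with rfl | h
    · exact ⟨[], _, rfl⟩
    · obtain ⟨A, B, e⟩ := ih h
      exact ⟨clauseStr n D ++ dolSym :: A, B, by simp [e]⟩

/-- There exists a nonempty string of length at most `n`
absent from `S'` iff the 3-CNF `F` is satisfiable. -/
theorem absent_word_iff_satisfiable (n : ℕ) (hn : 0 < n) (F : List (Clause3 n)) :
    (∃ P : List OB, P ≠ [] ∧ P.length ≤ n ∧ ¬ ∃ i : ℕ, OccursAt (mawS n F) P i) ↔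
      ∃ σ : Fin n → Bool, ∀ C ∈ F, C.Sat σ := by
  constructor
  · rintro ⟨P, hP0, hPn, hP⟩
    have occ : ∀ A M B, mawS n F = A ++ (M ++ B) →
        ¬ List.Forall₂ (fun x A => x ∈ A) P M := by
      intro A M B e hM
      apply hP
      rw [e]
      exact aux_occurs A M B P (e ▸ aux_nonempty n F) hM
    by_cases hd : none ∈ P
    · exfalso
      obtain ⟨u, v, rfl, hv⟩ := aux_split P hd
      simp only [List.length_append, List.length_cons] at hPn
      refine occ ((F.map fun C => clauseStr n C ++ [dolSym]).flatten ++
        List.replicate (n - 1 - u.length) triSym)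
        (List.replicate u.length triSym ++ dolSym :: List.replicate v.length bitSym)
        (List.replicate (n - 1 - v.length) bitSym) ?_ ?_
      · have e1 : List.replicate (n - 1) triSym = List.replicate (n - 1 - u.length) triSym
            ++ List.replicate u.length triSym := by
          rw [List.replicate_append_replicate]; congr 1; omega
        have e2 : List.replicate (n - 1) bitSym = List.replicate v.length bitSym
            ++ List.replicate (n - 1 - v.length) bitSym := by
          rw [List.replicate_append_replicate]; congr 1; omega
        rw [mawS, e1, e2]
        simp only [List.append_assoc, List.cons_append, List.nil_append]
      · exact List.rel_append (aux_tri u) (List.Forall₂.cons (by simp [dolSym]) (aux_bit v hv))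
    · have hl : P.length = n := by
        by_contra hne
        refine occ ((F.map fun C => clauseStr n C ++ [dolSym]).flatten)
          (List.replicate P.length triSym)
          (List.replicate (n - 1 - P.length) triSym ++ ([dolSym] ++
            List.replicate (n - 1) bitSym)) ?_ (aux_tri P)
        have e1 : List.replicate (n - 1) triSym = List.replicate P.length triSym
            ++ List.replicate (n - 1 - P.length) triSym := by
          rw [List.replicate_append_replicate]; congr 1; omega
        rw [mawS, e1]
        simp only [List.append_assoc]
      obtain ⟨σ, rfl⟩ := aux_bits P hl hd
      refine ⟨σ, fun C hC => ?_⟩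
      by_contra hs
      obtain ⟨A, B, e⟩ := aux_clause_mem F C hC
      exact occ A _ B e (aux_clause C σ hs)
  · rintro ⟨σ, hσ⟩
    refine ⟨bits σ, ?_, by simp [bits], ?_⟩
    · intro h
      have := congrArg List.length h
      simp [bits] at this
      omega
    · rintro ⟨i, hi⟩
      exact aux_absent n hn σ F hσ i (aux_pointwise _ σ i hi)
end

section
/- Let G = (V,E) be an undirected graph without self-loops on n ≥ 2 vertices, let S be the GD string constructed from G as described, and set k = 2(n(n−1)/2 − |E| + n) − 1. Let φ : {c_1,…,c_n} → {0,1}^⌈log₂ n⌉ be any injective map assigning to each character a bitstring of length ⌈log₂ n⌉, and let S_b be the GD string over {0,1} obtained from S by replacing every character of every string in every symbol by its image under φ. Then some string in L(S_b) is a k-anti-power if and only if G has a Hamiltonian path. -/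
/-- The language of a GD string `S` (a list of nonempty sets of strings):
all concatenations `w_1 ⋯ w_N` with `w_i ∈ S[i]`. -/
def GLang {α : Type*} (S : List (Set (List α))) : Set (List α) :=
  {T | ∃ ws : List (List α), List.Forall₂ (fun w A => w ∈ A) ws S ∧ ws.flatten = T}

/-- A classic string `T` is a `k`-anti-power: `|T| = k · ℓ` for some `ℓ ≥ 1` and
the `k` consecutive factors of length `ℓ` are pairwise distinct. -/
def IsAntipower {α : Type*} (k : ℕ) (T : List α) : Prop :=
  ∃ ℓ : ℕ, 1 ≤ ℓ ∧ T.length = k * ℓ ∧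
    ∀ j₁ j₂ : ℕ, j₁ < k → j₂ < k → j₁ ≠ j₂ →
      (T.drop (j₁ * ℓ)).take ℓ ≠ (T.drop (j₂ * ℓ)).take ℓ

/-- The four singleton symbols `c_u c_v c_v c_u` built from the non-edge
`p = {u, v}`. -/
def pairStr {n : ℕ} (p : Fin n × Fin n) : List (Set (List (Fin n))) :=
  [{[p.1]}, {[p.2]}, {[p.2]}, {[p.1]}]

/-- The symbol `A_3 = { c_v c_v c_v : v ∈ V }`. -/
def A3 (n : ℕ) : Set (List (Fin n)) := Set.range fun v : Fin n => [v, v, v]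

/-- The symbol `A_4 = { c_v c_v c_v c_v : v ∈ V }`. -/
def A4 (n : ℕ) : Set (List (Fin n)) := Set.range fun v : Fin n => [v, v, v, v]

/-- The GD string `S = S_1 ⋯ S_{|Ē|} · A_3 · A_4^{n-2} · A_3` built from an
enumeration `NE` of the non-edges of the graph. The alphabet is `Fin n`,
identifying the character `c_v` with the vertex `v`. -/
def gdS {n : ℕ} (NE : List (Fin n × Fin n)) : List (Set (List (Fin n))) :=
  (NE.map pairStr).flatten ++ [A3 n] ++ List.replicate (n - 2) (A4 n) ++ [A3 n]

theorem GLang_nil {α : Type*} (T : List α) : T ∈ GLang ([] : List (Set (List α))) ↔ T = [] := by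
  simp [GLang, eq_comm]

theorem GLang_cons {α : Type*} (A : Set (List α)) (S : List (Set (List α))) (T : List α) :
    T ∈ GLang (A :: S) ↔ ∃ a ∈ A, ∃ t ∈ GLang S, T = a ++ t := by
  constructor
  · rintro ⟨ws, h, rfl⟩
    cases h with
    | cons h1 h2 => exact ⟨_, h1, _, ⟨_, h2, rfl⟩, by simp⟩
  · rintro ⟨a, ha, t, ⟨ws, h, rfl⟩, rfl⟩
    exact ⟨a :: ws, List.Forall₂.cons ha h, by simp⟩

theorem GLang_map {α β : Type*} (φ : α → List β) (S : List (Set (List α))) (Y : List β) :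
    Y ∈ GLang (S.map (Set.image fun w : List α => (w.map φ).flatten)) ↔
      ∃ T ∈ GLang S, Y = (T.map φ).flatten := by
  induction S generalizing Y with
  | nil => simp [GLang_nil]
  | cons A S ih =>
    rw [List.map_cons, GLang_cons]
    simp only [GLang_cons, ih]
    constructor
    · rintro ⟨_, ⟨a, ha, rfl⟩, _, ⟨T, hT, rfl⟩, rfl⟩
      exact ⟨a ++ T, ⟨a, ha, T, hT, rfl⟩, by simp⟩
    · rintro ⟨_, ⟨a, ha, T, hT, rfl⟩, rfl⟩
      exact ⟨_, ⟨a, ha, rfl⟩, _, ⟨T, hT, rfl⟩, by simp⟩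

def flatP {α : Type*} (P : List (α × α)) : List α := P.flatMap fun p => [p.1, p.2]

def pth {α : Type*} : List α → List (α × α)
  | [] => []
  | [a] => [(a, a)]
  | a :: b :: l => (a, a) :: (a, b) :: pth (b :: l)

def neP {α : Type*} (NE : List (α × α)) : List (α × α) := NE.flatMap fun p => [p, p.swap]

theorem GLang_NE {n : ℕ} (NE : List (Fin n × Fin n)) (R : List (Set (List (Fin n))))
    (T : List (Fin n)) :
    T ∈ GLang ((NE.map pairStr).flatten ++ R) ↔ ∃ r ∈ GLang R, T = flatP (neP NE) ++ r := by
  induction NE generalizing T with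
  | nil => simp [neP, flatP]
  | cons p NE ih =>
    simp only [List.map_cons, List.flatten_cons, pairStr, List.cons_append, List.nil_append,
      GLang_cons, ih]
    simp [neP, flatP]

theorem GLang_tail {n : ℕ} (m : ℕ) (T : List (Fin n)) :
    T ∈ GLang (List.replicate m (A4 n) ++ [A3 n]) ↔
      ∃ vs : List (Fin n), vs.length = m + 1 ∧
        ∀ a, flatP (pth (a :: vs)) = a :: a :: a :: T := by
  induction m generalizing T with
  | zero =>
    simp only [List.replicate_zero, List.nil_append, GLang_cons, GLang_nil, A3]
    constructor
    · rintro ⟨_, ⟨b, rfl⟩, _, rfl, rfl⟩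
      exact ⟨[b], by simp, by simp [pth, flatP]⟩
    · rintro ⟨vs, h, h2⟩
      obtain ⟨b, rfl⟩ := List.length_eq_one_iff.1 h
      refine ⟨_, ⟨b, rfl⟩, _, rfl, ?_⟩
      have := h2 b
      simp [pth, flatP] at this
      simp [← this]
  | succ m ih =>
    simp only [List.replicate_succ, List.cons_append, GLang_cons, ih]
    constructor
    · rintro ⟨_, ⟨b, rfl⟩, t, ⟨vs, h, h2⟩, rfl⟩
      refine ⟨b :: vs, by simp [h], fun a => ?_⟩
      have := h2 b
      simp only [flatP] at this
      simp [pth, flatP, this]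
    · rintro ⟨vs, h, h2⟩
      match vs, h with
      | b :: c :: vs, h =>
        have := h2 b
        refine ⟨_, ⟨b, rfl⟩, flatP ((c, c) :: pth (c :: vs)) |>.tail, ⟨c :: vs, by simpa using h, ?_⟩, ?_⟩
        · intro a
          simp [pth, flatP]
        · simp [pth, flatP] at this
          simp [flatP, ← this]

theorem GLang_gdS {n : ℕ} (hn : 2 ≤ n) (NE : List (Fin n × Fin n)) (T : List (Fin n)) :
    T ∈ GLang (gdS NE) ↔
      ∃ vs : List (Fin n), vs.length = n ∧ T = flatP (neP NE ++ pth vs) := by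
  unfold gdS
  rw [List.append_assoc, List.append_assoc, GLang_NE]
  simp only [List.cons_append, List.nil_append, GLang_cons, GLang_tail]
  constructor
  · rintro ⟨_, ⟨_, ⟨a, rfl⟩, t, ⟨vs, h, h2⟩, rfl⟩, rfl⟩
    refine ⟨a :: vs, by simp [h]; omega, ?_⟩
    have := h2 a
    simp only [flatP] at this
    simp [flatP, this]
  · rintro ⟨vs, h, rfl⟩
    match vs, h with
    | [], h => simp at h; omega
    | [a], h => simp at h; omega
    | a :: b :: vs, h =>
      refine ⟨flatP (pth (a :: b :: vs)), ⟨_, ⟨a, rfl⟩, (flatP (pth (a :: b :: vs))).drop 3,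
        ⟨b :: vs, by simp at h ⊢; omega, ?_⟩, ?_⟩, ?_⟩
      · simp [pth, flatP]
      · simp [pth, flatP]
      · simp [flatP]

theorem antipower_iff {β : Type*} (L : ℕ) (hL : 1 ≤ L) (bs : List (List β))
    (hb : ∀ b ∈ bs, b.length = L) : IsAntipower bs.length bs.flatten ↔ bs.Nodup := by
  have hlen : bs.flatten.length = bs.length * L := by
    clear hL
    induction bs with
    | nil => simp
    | cons b bs ih =>
      simp only [List.mem_cons, forall_eq_or_imp] at hb
      have := ih hb.2
      simp only [List.flatten_cons, List.length_append, List.length_cons, this, hb.1]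
      ring
  have hget : ∀ j (h : j < bs.length), (bs.flatten.drop (j * L)).take L = bs[j] := by
    clear hL hlen
    induction bs with
    | nil => simp
    | cons b bs ih =>
      simp only [List.mem_cons, forall_eq_or_imp] at hb
      intro j h
      cases j with
      | zero => simp [← hb.1]
      | succ j =>
        have e : (j + 1) * L = b.length + j * L := by rw [hb.1]; ring
        rw [e, List.flatten_cons, List.drop_length_add_append]
        simpa using ih hb.2 j (by simpa using h)
  rw [List.nodup_iff_injective_get]
  constructor
  · rintro ⟨l, hl, h1, h2⟩ i j hij
    have : l = L := by
      rw [hlen] at h1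
      exact (Nat.eq_of_mul_eq_mul_left (Nat.zero_lt_of_lt i.2) h1).symm
    subst this
    by_contra hne
    refine h2 i j i.2 j.2 (fun h => hne (Fin.ext h)) ?_
    rw [hget _ i.2, hget _ j.2]
    simpa using hij
  · intro h
    refine ⟨L, hL, hlen, fun i j hi hj hne he => hne ?_⟩
    rw [hget _ hi, hget _ hj] at he
    simpa using @h ⟨i, hi⟩ ⟨j, hj⟩ (by simpa using he)

theorem mem_pth {α : Type*} (l : List α) (p : α × α) (h : p ∈ pth l) : p.1 ∈ l ∧ p.2 ∈ l := by
  fun_induction pth l with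
  | case1 => simp at h
  | case2 a => simp at h; simp [h]
  | case3 a b l ih =>
    simp only [List.mem_cons] at h ih ⊢
    rcases h with rfl | rfl | h
    · simp
    · simp
    · exact ⟨Or.inr (ih h).1, Or.inr (ih h).2⟩

theorem sub_pth {α : Type*} (l : List α) : (l.map fun a => (a, a)).Sublist (pth l) := by
  fun_induction pth l with
  | case1 => simp
  | case2 a => simp
  | case3 a b l ih => exact (ih.cons _).cons_cons _

theorem nodup_pth {α : Type*} (l : List α) : (pth l).Nodup ↔ l.Nodup := by
  constructor
  · intro h
    exact (h.sublist (sub_pth l)).of_map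
  · intro h
    fun_induction pth l with
    | case1 => simp
    | case2 a => simp
    | case3 a b l ih =>
      rw [List.nodup_cons] at h
      have h1 : ∀ c, (a, c) ∉ pth (b :: l) := fun c hc => h.1 (mem_pth _ _ hc).1
      have hab : a ≠ b := fun e => h.1 (by simp [e])
      simp [List.nodup_cons, h1, ih h.2, hab]

theorem chain_pth {n : ℕ} (G : SimpleGraph (Fin n)) (l : List (Fin n)) (h : l.Nodup) :
    (∀ p ∈ pth l, ¬ Gᶜ.Adj p.1 p.2) ↔ l.IsChain G.Adj := by
  fun_induction pth l with
  | case1 => simp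
  | case2 a => simp
  | case3 a b l ih =>
    rw [List.nodup_cons] at h
    have hab : a ≠ b := fun e => h.1 (by simp [e])
    rw [List.isChain_cons_cons, ← ih h.2]
    simp [SimpleGraph.compl_adj, hab]

theorem length_pth {α : Type*} (l : List α) : (pth l).length = 2 * l.length - 1 := by
  fun_induction pth l with
  | case1 => simp
  | case2 a => simp
  | case3 a b l ih => simp only [List.length_cons] at ih ⊢; omega

theorem length_neP {α : Type*} (l : List (α × α)) : (neP l).length = 2 * l.length := by
  simp [neP, mul_comm]

theorem mem_neP {n : ℕ} (G : SimpleGraph (Fin n)) (NE : List (Fin n × Fin n))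
    (hNE2 : ∀ u v : Fin n, s(u, v) ∈ NE.map (fun p => s(p.1, p.2)) ↔ Gᶜ.Adj u v)
    (p : Fin n × Fin n) : p ∈ neP NE ↔ Gᶜ.Adj p.1 p.2 := by
  rw [← hNE2]
  simp only [neP, List.mem_flatMap, List.mem_map]
  refine exists_congr fun q => and_congr_right fun _ => ?_
  obtain ⟨a, b⟩ := p
  obtain ⟨c, d⟩ := q
  simp
  grind

theorem nodup_neP {n : ℕ} (NE : List (Fin n × Fin n))
    (hNE1 : (NE.map fun p => s(p.1, p.2)).Nodup)
    (h : ∀ p ∈ NE, p.1 ≠ p.2) : (neP NE).Nodup := by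
  induction NE with
  | nil => simp [neP]
  | cons p NE ih =>
    simp only [List.map_cons, List.nodup_cons] at hNE1
    simp only [List.mem_cons, forall_eq_or_imp] at h
    have := ih hNE1.2 h.2
    have e : neP (p :: NE) = p :: p.swap :: neP NE := by simp [neP]
    have key : ∀ q ∈ neP NE, s(q.1, q.2) ∈ NE.map fun p => s(p.1, p.2) := by
      intro q hq
      simp only [neP, List.mem_flatMap] at hq
      obtain ⟨r, hr, hq⟩ := hq
      refine List.mem_map.2 ⟨r, hr, ?_⟩
      simp at hq
      rcases hq with rfl | rfl
      · rfl
      · simp [Sym2.eq_swap]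
    rw [e, List.nodup_cons, List.nodup_cons]
    refine ⟨?_, ?_, this⟩
    · rw [List.mem_cons, not_or]
      exact ⟨fun e => h.1 (congrArg Prod.fst e), fun hm => hNE1.1 (key _ hm)⟩
    · intro hm
      apply hNE1.1
      have := key _ hm
      rwa [Prod.fst_swap, Prod.snd_swap, Sym2.eq_swap] at this

theorem length_NE {n : ℕ} (G : SimpleGraph (Fin n)) [DecidableRel G.Adj]
    (NE : List (Fin n × Fin n)) (hNE1 : (NE.map fun p => s(p.1, p.2)).Nodup)
    (hNE2 : ∀ u v : Fin n, s(u, v) ∈ NE.map (fun p => s(p.1, p.2)) ↔ Gᶜ.Adj u v) :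
    NE.length = n * (n - 1) / 2 - G.edgeFinset.card := by
  have h1 : (NE.map fun p => s(p.1, p.2)).toFinset = Gᶜ.edgeFinset := by
    ext e
    induction e with
    | _ u v => rw [List.mem_toFinset, hNE2, SimpleGraph.mem_edgeFinset, SimpleGraph.mem_edgeSet]
  have h2 := List.toFinset_card_of_nodup hNE1
  rw [h1, List.length_map] at h2
  have h3 : G.edgeFinset.card + Gᶜ.edgeFinset.card = n * (n - 1) / 2 := by
    have h4 : Disjoint G.edgeFinset Gᶜ.edgeFinset := by
      rw [SimpleGraph.disjoint_edgeFinset]; exact disjoint_compl_right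
    rw [← Finset.card_union_of_disjoint h4, ← Nat.choose_two_right]
    have h5 := SimpleGraph.card_edgeFinset_top_eq_card_choose_two (V := Fin n)
    rw [Fintype.card_fin] at h5
    rw [← h5]
    congr 1
    ext e
    induction e with
    | _ u v =>
      simp [SimpleGraph.mem_edgeSet, SimpleGraph.compl_adj]
      constructor
      · rintro (h | h)
        · exact h.ne
        · exact h.1
      · intro h
        by_cases G.Adj u v <;> simp_all
  omega

theorem flatP_map {α β : Type*} (φ : α → List β) (P : List (α × α)) :
    ((flatP P).map φ).flatten = (P.map fun p => φ p.1 ++ φ p.2).flatten := by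
  induction P with
  | nil => simp [flatP]
  | cons p P ih =>
    simp only [flatP] at ih
    simp [flatP, ih]

/-- Let `G` be an undirected graph without self-loops on
`n ≥ 2` vertices, `NE` an enumeration (without repetitions) of its non-edges,
`S` the constructed GD string, and `k = 2(n(n-1)/2 - |E| + n) - 1`.
Let `φ` be any injective map assigning to each character (vertex) a bitstring of
length `⌈log₂ n⌉`, and let `S_b` be the GD string over `{0,1}` obtained from `S`
by replacing every character of every string in every symbol by its image
under `φ`. Then some string in `L(S_b)` is a `k`-anti-power iff `G` has a
Hamiltonian path. -/
theorem gdS_binary_has_antipower_iff_hamiltonian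
    (n : ℕ) (hn : 2 ≤ n) (G : SimpleGraph (Fin n))
    [DecidableRel G.Adj] (NE : List (Fin n × Fin n))
    (hNE1 : (NE.map fun p => s(p.1, p.2)).Nodup)
    (hNE2 : ∀ u v : Fin n, s(u, v) ∈ NE.map (fun p => s(p.1, p.2)) ↔ Gᶜ.Adj u v)
    (k : ℕ) (hk : k = 2 * (n * (n - 1) / 2 - G.edgeFinset.card + n) - 1)
    (φ : Fin n → List Bool) (hφ : Function.Injective φ)
    (hφlen : ∀ v : Fin n, (φ v).length = Nat.clog 2 n) :
    (∃ Y ∈ GLang ((gdS NE).map (Set.image fun w : List (Fin n) => (w.map φ).flatten)),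
        IsAntipower k Y) ↔
      ∃ W : Fin n → Fin n, Function.Injective W ∧
        ∀ (j : ℕ) (h : j + 1 < n), G.Adj (W ⟨j, by omega⟩) (W ⟨j + 1, h⟩) := by
  set P : List (Fin n) → List (Fin n × Fin n) := fun vs => neP NE ++ pth vs with hP
  have hNEne : ∀ p ∈ NE, p.1 ≠ p.2 := by
    intro p hp
    exact ((hNE2 p.1 p.2).1 (List.mem_map.2 ⟨p, hp, rfl⟩)).ne
  have hclog : 1 ≤ Nat.clog 2 n := Nat.clog_pos (by norm_num) hn
  have hinj : Function.Injective fun p : Fin n × Fin n => φ p.1 ++ φ p.2 := by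
    rintro ⟨a, b⟩ ⟨c, d⟩ h
    have := List.append_inj h (by simp [hφlen])
    exact Prod.ext (hφ this.1) (hφ this.2)
  have hanti : ∀ vs : List (Fin n), vs.length = n →
      (IsAntipower k (((flatP (P vs)).map φ).flatten) ↔ vs.Nodup ∧ vs.IsChain G.Adj) := by
    intro vs hvs
    have hk' : k = ((P vs).map fun p => φ p.1 ++ φ p.2).length := by
      rw [List.length_map, hP, List.length_append, length_neP, length_pth, hvs,
        length_NE G NE hNE1 hNE2, hk]
      omega
    rw [flatP_map, hk', antipower_iff (2 * Nat.clog 2 n) (by omega), List.nodup_map_iff hinj, hP,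
      List.nodup_append, nodup_pth]
    · constructor
      · rintro ⟨-, h1, h2⟩
        refine ⟨h1, (chain_pth G vs h1).1 fun p hp hc => ?_⟩
        exact h2 p ((mem_neP G NE hNE2 p).2 hc) p hp rfl
      · rintro ⟨h1, h2⟩
        refine ⟨nodup_neP NE hNE1 hNEne, h1, ?_⟩
        rintro p hp q hq rfl
        exact (chain_pth G vs h1).2 h2 p hq ((mem_neP G NE hNE2 p).1 hp)
    · intro b hb
      obtain ⟨p, -, rfl⟩ := List.mem_map.1 hb
      simp [hφlen]; omega
  constructor
  · rintro ⟨Y, hY, hA⟩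
    obtain ⟨T, hT, rfl⟩ := (GLang_map _ _ _).1 hY
    obtain ⟨vs, hvs, rfl⟩ := (GLang_gdS hn _ _).1 hT
    obtain ⟨h1, h2⟩ := (hanti vs hvs).1 hA
    refine ⟨fun i => vs.get (i.cast hvs.symm), ?_, ?_⟩
    · intro i j hij
      simpa using List.nodup_iff_injective_get.1 h1 hij
    · intro j h
      exact List.isChain_iff_getElem.1 h2 j (by omega)
  · rintro ⟨W, hW, hW2⟩
    refine ⟨_, (GLang_map _ _ _).2 ⟨_, (GLang_gdS hn _ _).2 ⟨List.ofFn W, by simp, rfl⟩, rfl⟩, ?_⟩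
    refine (hanti _ (by simp)).2 ⟨List.nodup_ofFn.2 hW, ?_⟩
    rw [List.isChain_iff_getElem]
    intro i hi
    simpa using hW2 i (by simpa using hi)
end

section
/- Let S_1,…,S_f (f ≥ 1) be nonempty strings over an alphabet Σ, let k ≥ 1, let ℓ ≥ 3 be minimal with k(ℓ−2) > |S_1| + ⋯ + |S_f|, and let S be the ED string constructed from S_1,…,S_f, k, ℓ as described. Then for every string T ∈ L(S) and every position i of T, the longest-previous-factor length LPF(T)[i] is at most (k+1)(f+ℓ)+1. -/
/- We model the alphabet `Σ ∪ {$}` as `Option α`: the character `$ ∉ Σ` is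
`none` and a character `x ∈ Σ` is `some x`. -/

/-- The ED symbol `Σ_ε = { x : x ∈ Σ } ∪ {ε}`, matching any one character of `Σ`
or nothing. -/
def sigmaEps (α : Type*) : Set (List (Option α)) :=
  {w | w = [] ∨ ∃ x : α, w = [some x]}

/-- The ED symbol `{$}` containing only the one-character string `$`. -/
def dolS (α : Type*) : Set (List (Option α)) := {[none]}

/-- The ED string `Ŝ_w = ({w[1], ε})({w[2], ε}) ⋯ ({w[|w|], ε})`,
whose language is the set of subsequences of `w`. -/
def subseqED {α : Type*} (w : List α) : List (Set (List (Option α))) :=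
  w.map fun c => ({[some c], []} : Set (List (Option α)))

/-- The ED string
`S = ({$} Σ_ε^k)^ℓ · {$} · Ŝ_1 · {$} · ⋯ · {$} · Ŝ_f · {$} · Σ_ε^k · {$}`
of the LPF reduction, built from the strings `SS = [S_1, …, S_f]` and the
integers `k` and `ℓ`. -/
def lpfS {α : Type*} (SS : List (List α)) (k ℓ : ℕ) : List (Set (List (Option α))) :=
  (List.replicate ℓ ([dolS α] ++ List.replicate k (sigmaEps α))).flatten ++
    [dolS α] ++ (SS.map fun w => subseqED w ++ [dolS α]).flatten ++
    List.replicate k (sigmaEps α) ++ [dolS α]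

theorem aux_cnt (k : ℕ) : ∀ (L : ℕ) (Q : ℕ → Prop) [DecidablePred Q],
    (∀ t, t + k < L → ∃ s, t ≤ s ∧ s ≤ t + k ∧ Q s) →
    L ≤ Nat.count Q L * (k + 1) + k := by
  intro L
  induction L using Nat.strong_induction_on with
  | _ L ih =>
    intro Q _ h
    by_cases hL : L ≤ k
    · omega
    obtain ⟨M, rfl⟩ : ∃ M, L = (k + 1) + M := ⟨L - (k + 1), by omega⟩
    have h1 := ih M (by omega) (fun x => Q (k + 1 + x)) (by
      intro t ht
      obtain ⟨s, hs1, hs2, hs3⟩ := h (k + 1 + t) (by omega)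
      exact ⟨s - (k + 1), by omega, by omega, by
        have : k + 1 + (s - (k + 1)) = s := by omega
        simpa [this] using hs3⟩)
    rw [Nat.count_add]
    obtain ⟨s, hs1, hs2, hs3⟩ := h 0 (by omega)
    have h2 : 1 ≤ Nat.count Q (k + 1) := by
      have h3 : Nat.count Q (s + 1) ≤ Nat.count Q (k + 1) := Nat.count_monotone Q (by omega)
      rw [Nat.count_succ, if_pos hs3] at h3
      omega
    nlinarith

theorem aux_cnt_start (k L : ℕ) (Q : ℕ → Prop) [DecidablePred Q] (hL : 1 ≤ L) (h0 : Q 0)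
    (h : ∀ t, t + k < L → ∃ s, t ≤ s ∧ s ≤ t + k ∧ Q s) :
    L ≤ Nat.count Q L * (k + 1) := by
  obtain ⟨M, rfl⟩ : ∃ M, L = M + 1 := ⟨L - 1, by omega⟩
  have h1 := aux_cnt k M (fun x => Q (x + 1)) (by
      intro t ht
      obtain ⟨s, hs1, hs2, hs3⟩ := h (t + 1) (by omega)
      exact ⟨s - 1, by omega, by omega, by
        have : s - 1 + 1 = s := by omega
        simpa [this] using hs3⟩)
  rw [Nat.count_succ', if_pos h0]
  nlinarith

theorem aux_cnt_end (k L : ℕ) (Q : ℕ → Prop) [DecidablePred Q] (hL : 1 ≤ L) (h0 : Q (L - 1))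
    (h : ∀ t, t + k < L → ∃ s, t ≤ s ∧ s ≤ t + k ∧ Q s) :
    L ≤ Nat.count Q L * (k + 1) := by
  obtain ⟨M, rfl⟩ : ∃ M, L = M + 1 := ⟨L - 1, by omega⟩
  have h1 := aux_cnt k M Q (fun t ht => h t (by omega))
  simp only [Nat.add_sub_cancel] at h0
  rw [Nat.count_succ, if_pos h0]
  nlinarith

theorem aux_cnt_both (k L : ℕ) (Q : ℕ → Prop) [DecidablePred Q] (hL : 2 ≤ L) (h0 : Q 0)
    (h0' : Q (L - 1))
    (h : ∀ t, t + k < L → ∃ s, t ≤ s ∧ s ≤ t + k ∧ Q s) :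
    L + k ≤ Nat.count Q L * (k + 1) := by
  obtain ⟨M, rfl⟩ : ∃ M, L = M + 1 := ⟨L - 1, by omega⟩
  have h1 := aux_cnt_start k M Q (by omega) h0 (fun t ht => h t (by omega))
  simp only [Nat.add_sub_cancel] at h0'
  rw [Nat.count_succ, if_pos h0']
  nlinarith

theorem aux_main (P : ℕ → Prop) [DecidablePred P] (n pl k ℓ f E i j L : ℕ) (hk : 1 ≤ k)
    (hℓ3 : 3 ≤ ℓ) (hf : 1 ≤ f) (hE : E < k * (ℓ - 2))
    (hP0 : P 0) (hPn : P (n - 1)) (hcount : Nat.count P n = ℓ + f + 2)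
    (hpl : P pl) (hwin : ∀ t, t + k ≤ pl → ∃ s, t ≤ s ∧ s ≤ t + k ∧ P s)
    (hn : n ≤ pl + 1 + E + f + k + 1)
    (hji : j < i) (hi : i + L ≤ n) (hper : ∀ q < L, (P (j + q) ↔ P (i + q))) :
    L ≤ (k + 1) * (f + ℓ) + 1 := by
  obtain ⟨l, rfl⟩ : ∃ l, ℓ = l + 2 := ⟨ℓ - 2, by omega⟩
  simp only [Nat.add_sub_cancel] at hE
  by_cases hc : pl < i
  · nlinarith
  push Not at hc
  have hW : ∀ t, t + k < i + L → ∃ s, t ≤ s ∧ s ≤ t + k ∧ P s := by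
    intro t
    induction t using Nat.strong_induction_on with
    | _ t ih =>
      intro ht
      by_cases h1 : t + k ≤ pl
      · exact hwin t h1
      by_cases h2 : t < i
      · exact ⟨pl, by omega, by omega, hpl⟩
      obtain ⟨s, hs1, hs2, hs3⟩ := ih (t - (i - j)) (by omega) (by omega)
      refine ⟨s + (i - j), by omega, by omega, ?_⟩
      have := hper (s - j) (by omega)
      rw [show j + (s - j) = s by omega, show i + (s - j) = s + (i - j) by omega] at this
      exact this.1 hs3
  set Q : ℕ → Prop := fun q => P (i + q) with hQ
  have hWQ : ∀ t, t + k < L → ∃ s, t ≤ s ∧ s ≤ t + k ∧ Q s := by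
    intro t ht
    obtain ⟨s, hs1, hs2, hs3⟩ := hW (i + t) (by omega)
    exact ⟨s - i, by omega, by omega, by
      simpa [hQ, show i + (s - i) = s by omega] using hs3⟩
  have hcj : Nat.count P (j + L) = Nat.count P j + Nat.count Q L := by
    rw [Nat.count_add]
    congr 1
    rw [Nat.count_eq_card_filter_range, Nat.count_eq_card_filter_range]
    congr 1
    apply Finset.filter_congr
    intro q hq
    exact hper q (Finset.mem_range.1 hq)
  have hci : Nat.count P (i + L) = Nat.count P i + Nat.count Q L := by
    rw [Nat.count_add]
  have hnpos : 1 ≤ n := by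
    by_contra h
    have : n = 0 := by omega
    subst this
    simp at hcount
  have hlast : ∀ a, a < n → Nat.count P a ≤ l + f + 3 := by
    intro a ha
    have h1 : Nat.count P a ≤ Nat.count P (n - 1) := Nat.count_monotone P (by omega)
    have h2 : Nat.count P (n - 1 + 1) = Nat.count P (n - 1) + 1 := by
      rw [Nat.count_succ, if_pos hPn]
    rw [Nat.sub_add_cancel hnpos] at h2
    omega
  have hfirst : ∀ a, 0 < a → 1 ≤ Nat.count P a := by
    intro a ha
    have h1 : Nat.count P 1 ≤ Nat.count P a := Nat.count_monotone P (by omega)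
    rw [Nat.count_succ, if_pos hP0] at h1
    omega
  have hle : Nat.count P (i + L) ≤ l + f + 4 := by
    have := Nat.count_monotone P hi
    omega
  have hQ0 : Nat.count P j = 0 → 1 ≤ L → Q 0 := by
    intro h hL
    have : j = 0 := by
      by_contra h'
      have := hfirst j (by omega)
      omega
    subst this
    exact (hper 0 (by omega)).1 hP0
  have hQe : Nat.count P (i + L) = l + f + 4 → 1 ≤ L → Q (L - 1) := by
    intro h hL
    have : i + L = n := by
      by_contra h'
      have := hlast (i + L) (by omega)
      omega
    simp only [hQ]
    rw [show i + (L - 1) = n - 1 by omega]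
    exact hPn
  have hgt : 1 ≤ Nat.count Q L → Nat.count P j + 1 ≤ Nat.count P i := by
    intro h
    have hex : ∃ q, q < L ∧ Q q := by
      by_contra hne
      push Not at hne
      have : Nat.count Q L = 0 := by
        rw [Nat.count_eq_card_filter_range, Finset.card_eq_zero, Finset.filter_eq_empty_iff]
        intro q hq
        exact hne q (Finset.mem_range.1 hq)
      omega
    classical
    have hq := Nat.find_spec hex
    have hmin := fun m => Nat.find_min hex (m := m)
    set q := Nat.find hex
    have h1 : Nat.count P (i + q) = Nat.count P i := by
      rw [Nat.count_add]
      have : Nat.count (fun x => P (i + x)) q = 0 := by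
        rw [Nat.count_eq_card_filter_range, Finset.card_eq_zero, Finset.filter_eq_empty_iff]
        intro x hx hx2
        have hx := Finset.mem_range.1 hx
        exact hmin x hx ⟨by omega, hx2⟩
      omega
    have h2 : Nat.count P (j + q + 1) ≤ Nat.count P (i + q) := Nat.count_monotone P (by omega)
    rw [Nat.count_succ, if_pos ((hper q hq.1).2 hq.2)] at h2
    have h3 : Nat.count P j ≤ Nat.count P (j + q) := Nat.count_monotone P (by omega)
    omega
  have hjle := fun h : 1 ≤ L => hlast (j + L) (by omega)
  have hfi := hfirst i (by omega)
  by_cases hL : L < 2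
  · nlinarith
  generalize hm : Nat.count Q L = m at *
  have c1 := aux_cnt k L Q hWQ
  rw [hm] at c1
  have hj' := hjle (by omega)
  by_cases m0 : m = 0
  · subst m0; nlinarith
  have hgt' := hgt (by omega)
  by_cases m1 : m + 1 ≤ f + (l + 2)
  · have : (m + 1) * (k + 1) ≤ (f + (l + 2)) * (k + 1) := Nat.mul_le_mul_right _ m1
    nlinarith
  by_cases m2 : m = f + (l + 2)
  · have : L ≤ m * (k + 1) := by
      by_cases hj0 : Nat.count P j = 0
      · rw [← hm]; exact aux_cnt_start k L Q (by omega) (hQ0 hj0 (by omega)) hWQ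
      · rw [← hm]; exact aux_cnt_end k L Q (by omega) (hQe (by omega) (by omega)) hWQ
    rw [m2] at this
    nlinarith
  have m3 : m = f + (l + 2) + 1 := by omega
  have := aux_cnt_both k L Q (by omega) (hQ0 (by omega) (by omega)) (hQe (by omega) (by omega)) hWQ
  rw [hm, m3] at this
  nlinarith

/-- position `t` of `T` holds the separator -/
def pd {α : Type*} (T : List (Option α)) (t : ℕ) : Prop := T[t]?.any Option.isNone = true

instance {α : Type*} (T : List (Option α)) : DecidablePred (pd T) := fun t => by
  unfold pd; infer_instance

theorem pd_append_right {α : Type*} (A B : List (Option α)) (t : ℕ) :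
    pd (A ++ B) (A.length + t) ↔ pd B t := by
  unfold pd
  rw [List.getElem?_append_right (Nat.le_add_right _ _), Nat.add_sub_cancel_left]

theorem pd_append_left {α : Type*} (A B : List (Option α)) (t : ℕ) (h : t < A.length) :
    pd (A ++ B) t ↔ pd A t := by
  simp [pd, List.getElem?_append_left h]

theorem count_pd {α : Type*} (T : List (Option α)) :
    Nat.count (pd T) T.length = T.countP Option.isNone := by
  induction T with
  | nil => simp
  | cons a T ih =>
    rw [List.length_cons, Nat.count_succ', List.countP_cons, ← ih]
    congr 1

theorem glang_append {α : Type*} (A B : List (Set (List α))) (T : List α)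
    (h : T ∈ GLang (A ++ B)) : ∃ X ∈ GLang A, ∃ Y ∈ GLang B, T = X ++ Y := by
  obtain ⟨ws, hw, rfl⟩ := h
  have h1 := List.forall₂_take_append _ _ _ hw
  have h2 := List.forall₂_drop_append _ _ _ hw
  refine ⟨_, ⟨_, h1, rfl⟩, _, ⟨_, h2, rfl⟩, ?_⟩
  rw [← List.flatten_append, List.take_append_drop]

theorem glang_cons {α : Type*} (A : Set (List α)) (B : List (Set (List α))) (T : List α)
    (h : T ∈ GLang (A :: B)) : ∃ X ∈ A, ∃ Y ∈ GLang B, T = X ++ Y := by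
  obtain ⟨ws, hw, rfl⟩ := h
  cases hw with
  | cons h1 h2 => exact ⟨_, h1, _, ⟨_, h2, rfl⟩, by simp⟩

theorem glang_nil {α : Type*} (T : List α) (h : T ∈ GLang ([] : List (Set (List α)))) : T = [] := by
  obtain ⟨ws, hw, rfl⟩ := h
  cases hw
  rfl

theorem glang_dol {α : Type*} (T : List (Option α)) (h : T ∈ GLang [dolS α]) : T = [none] := by
  obtain ⟨X, hX, Y, hY, rfl⟩ := glang_cons _ _ _ h
  rw [glang_nil _ hY]
  simpa [dolS] using hX

theorem glang_eps {α : Type*} (k : ℕ) : ∀ (T : List (Option α)),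
    T ∈ GLang (List.replicate k (sigmaEps α)) → T.length ≤ k ∧ T.countP Option.isNone = 0 := by
  induction k with
  | zero => intro T h; rw [glang_nil T h]; simp
  | succ k ih =>
    intro T h
    obtain ⟨X, hX, Y, hY, rfl⟩ := glang_cons _ _ _ h
    obtain ⟨h1, h2⟩ := ih Y hY
    rw [List.countP_append, List.length_append, h2]
    rcases hX with rfl | ⟨x, rfl⟩
    · simp; omega
    · simp; omega

theorem glang_sub {α : Type*} (w : List α) : ∀ (T : List (Option α)),
    T ∈ GLang (subseqED w) → T.length ≤ w.length ∧ T.countP Option.isNone = 0 := by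
  induction w with
  | nil => intro T h; rw [glang_nil T h]; simp
  | cons c w ih =>
    intro T h
    obtain ⟨X, hX, Y, hY, rfl⟩ := glang_cons _ _ _ h
    obtain ⟨h1, h2⟩ := ih Y hY
    rw [List.countP_append, List.length_append, h2]
    rcases hX with rfl | rfl
    · simp; omega
    · simp; omega

theorem glang_mid {α : Type*} (SS : List (List α)) : ∀ (T : List (Option α)),
    T ∈ GLang ((SS.map fun w => subseqED w ++ [dolS α]).flatten) →
    T.length ≤ (SS.map List.length).sum + SS.length ∧ T.countP Option.isNone = SS.length := by
  induction SS with
  | nil => intro T h; rw [glang_nil T h]; simp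
  | cons w SS ih =>
    intro T h
    rw [List.map_cons, List.flatten_cons] at h
    obtain ⟨X, hX, Y, hY, rfl⟩ := glang_append _ _ _ h
    obtain ⟨h1, h2⟩ := ih Y hY
    obtain ⟨Z, hZ, W, hW, rfl⟩ := glang_append _ _ _ hX
    obtain ⟨h3, h4⟩ := glang_sub _ _ hZ
    rw [glang_dol _ hW]
    constructor
    · simp only [List.length_append, List.length_cons, List.length_nil, List.map_cons,
        List.sum_cons]
      omega
    · simp [List.countP_append, h2, h4]

theorem glang_pre {α : Type*} (k l : ℕ) : ∀ (T : List (Option α)),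
    T ∈ GLang ((List.replicate l ([dolS α] ++ List.replicate k (sigmaEps α))).flatten) →
    T.countP Option.isNone = l ∧ pd (T ++ [none]) 0 ∧
    ∀ t, t + k ≤ T.length → ∃ s, t ≤ s ∧ s ≤ t + k ∧ pd (T ++ [none]) s := by
  induction l with
  | zero =>
    intro T h; rw [glang_nil T h]
    refine ⟨by simp, by simp [pd], ?_⟩
    intro t ht
    refine ⟨0, ?_, by omega, by simp [pd]⟩
    simp at ht; omega
  | succ l ih =>
    intro T h
    rw [List.replicate_succ, List.flatten_cons] at h
    obtain ⟨X, hX, Y, hY, rfl⟩ := glang_append _ _ _ h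
    obtain ⟨h1, h2, h3⟩ := ih Y hY
    obtain ⟨Z, hZ, W, hW, rfl⟩ := glang_append _ _ _ hX
    obtain ⟨h4, h5⟩ := glang_eps _ _ hW
    rw [glang_dol _ hZ]
    refine ⟨by simp [h1, h5], by simp [pd], ?_⟩
    intro t ht
    rw [List.append_assoc _ Y]
    have hlen : ([none] ++ W : List (Option α)).length = W.length + 1 := by simp
    rw [List.length_append, hlen] at ht
    have key : ∀ s, pd (Y ++ [none]) s → pd ([none] ++ W ++ (Y ++ [none])) (W.length + 1 + s) := by
      intro s hs
      rw [← hlen, pd_append_right]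
      exact hs
    by_cases t0 : t = 0
    · exact ⟨0, by omega, by omega, by simp [pd]⟩
    by_cases t1 : t ≤ W.length
    · exact ⟨W.length + 1 + 0, by omega, by omega, key 0 h2⟩
    obtain ⟨s, hs1, hs2, hs3⟩ := h3 (t - (W.length + 1)) (by omega)
    exact ⟨W.length + 1 + s, by omega, by omega, key s hs3⟩

/-- Let `S_1, …, S_f` (`f ≥ 1`) be nonempty strings over `Σ`,
`k ≥ 1`, and `ℓ ≥ 3` minimal with `k(ℓ-2) > |S_1| + ⋯ + |S_f|`. Then for every
`T ∈ L(S)` of the constructed ED string `S` and every position `i` of `T`, the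
longest-previous-factor length `LPF(T)[i]` is at most `(k+1)(f+ℓ)+1`; that is,
whenever a factor of length `L` starting at position `i` also occurs at an
earlier position `j < i` (both occurrences lying within `T`), then
`L ≤ (k+1)(f+ℓ)+1`. -/
theorem lpf_upper_bound {α : Type*} (SS : List (List α)) (hf : SS ≠ [])
    (hne : ∀ w ∈ SS, w ≠ []) (k : ℕ) (hk : 1 ≤ k) (ℓ : ℕ) (hℓ3 : 3 ≤ ℓ)
    (hℓ : (SS.map List.length).sum < k * (ℓ - 2))
    (hℓmin : ∀ ℓ' : ℕ, 3 ≤ ℓ' → (SS.map List.length).sum < k * (ℓ' - 2) → ℓ ≤ ℓ') :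
    ∀ T ∈ GLang (lpfS SS k ℓ), ∀ i < T.length, ∀ L j : ℕ, j < i →
      j + L ≤ T.length → i + L ≤ T.length →
      (T.drop j).take L = (T.drop i).take L →
      L ≤ (k + 1) * (SS.length + ℓ) + 1 := by
  intro T hT i hi L j hji hj hiL heq
  unfold lpfS at hT
  obtain ⟨T4, hT4, D2, hD2, rfl⟩ := glang_append _ _ _ hT
  obtain ⟨T3, hT3, Y, hY, rfl⟩ := glang_append _ _ _ hT4
  obtain ⟨T2, hT2, V, hV, rfl⟩ := glang_append _ _ _ hT3
  obtain ⟨X, hX, D1, hD1, rfl⟩ := glang_append _ _ _ hT2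
  obtain rfl := glang_dol _ hD1
  obtain rfl := glang_dol _ hD2
  obtain ⟨y1, y2⟩ := glang_eps _ _ hY
  obtain ⟨v1, v2⟩ := glang_mid _ _ hV
  obtain ⟨x1, x2, x3⟩ := glang_pre _ _ _ hX
  have hlift : ∀ s, s ≤ X.length → pd (X ++ [none]) s →
      pd (X ++ [none] ++ V ++ Y ++ [none]) s := by
    intro s hs h
    rw [List.append_assoc, List.append_assoc, pd_append_left _ _ _ (by simp; omega)]
    exact h
  refine aux_main (pd (X ++ [none] ++ V ++ Y ++ [none])) (X ++ [none] ++ V ++ Y ++ [none]).length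
    X.length k ℓ SS.length (SS.map List.length).sum i j L hk hℓ3
    (List.length_pos_iff.2 hf) hℓ (hlift 0 (by omega) x2) ?_ ?_ (hlift _ le_rfl (by simp [pd])) ?_
    ?_ hji hiL ?_
  · have : (X ++ [none] ++ V ++ Y ++ [none]).length - 1 = (X ++ [none] ++ V ++ Y).length + 0 := by
      rw [List.length_append (bs := [none])]
      rfl
    rw [this, pd_append_right]
    simp [pd]
  · rw [count_pd]
    simp [List.countP_append, y2, v2, x1]
    omega
  · intro t ht
    obtain ⟨s, hs1, hs2, hs3⟩ := x3 t ht
    exact ⟨s, hs1, hs2, hlift s (by omega) hs3⟩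
  · simp
    omega
  · intro q hq
    have h := congrArg (fun l => l[q]?) heq
    simp only [List.getElem?_take, hq, if_true, List.getElem?_drop] at h
    unfold pd
    rw [h]
end
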